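/- (Full time-ordered condition implies the causal condition.) Suppose θ satisfies the partial time-ordered condition. Let ζ_E : Fin m6 → Fin m1 and η : Fin m5 → Fin m1 be strictly increasing maps, define H_E : Matrix (Fin m6) (Fin m5) F by H_E j i = (P − I)_{ζ_E(j), η(i)}, and define w_i = {j : Fin m6 | ζ_E(j) ≤ η(i)}. Then the subsets w_i satisfy the causal condition: (A1) H_E j i = 0 whenever j ∈ w_i, and (A2) w_i ⊆ w_{i'} whenever i ≤ i'. -/

import Mathlib

/-- The matrix `M'_j` of the wiretap and addition model: its row with index `m3 + j`
is `[θ_{m3+j, j'} + δ_{m3+j, j'}]_{j'}`, and every other row is the corresponding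
row of the identity matrix. (Indices `j : Fin m7` are 0-based.) -/
def Mprime {F : Type*} [Field F] {m3 m7 : ℕ}
    (θ : Matrix (Fin (m3 + m7)) (Fin (m3 + m7)) F) (j : Fin m7) :
    Matrix (Fin (m3 + m7)) (Fin (m3 + m7)) F :=
  Matrix.of fun a b =>
    if a = Fin.natAdd m3 j then θ a b + (if a = b then (1 : F) else 0)
    else (if a = b then (1 : F) else 0)

/-- The product `P = M'_{m7} ⋯ M'_1`, with the factors in decreasing order of `j`
from left to right. -/
def Pprod {F : Type*} [Field F] {m3 m7 : ℕ}
    (θ : Matrix (Fin (m3 + m7)) (Fin (m3 + m7)) F) :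
    Matrix (Fin (m3 + m7)) (Fin (m3 + m7)) F :=
  ((List.finRange m7).reverse.map (Mprime θ)).prod

/-- Square matrices that agree with the identity on and above the diagonal are closed under
multiplication. -/
theorem Matrix.mul_apply_eq_one_apply_of_le {n R : Type*} [Fintype n] [LinearOrder n]
    [NonAssocSemiring R] {M N : Matrix n n R}
    (hM : ∀ a b, a ≤ b → M a b = (1 : Matrix n n R) a b)
    (hN : ∀ a b, a ≤ b → N a b = (1 : Matrix n n R) a b) (a b : n) (hab : a ≤ b) :
    (M * N) a b = (1 : Matrix n n R) a b := by
  rw [Matrix.mul_apply, Finset.sum_eq_single a]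
  · rw [hM a a le_rfl, Matrix.one_apply_eq, one_mul, hN a b hab]
  · intro c _ hca
    rcases lt_or_gt_of_ne hca with h | h
    · rw [hN c b (h.le.trans hab), Matrix.one_apply_ne (h.trans_le hab).ne, mul_zero]
    · rw [hM a c h.le, Matrix.one_apply_ne h.ne, zero_mul]
  · exact fun h => absurd (Finset.mem_univ a) h

theorem Matrix.list_prod_apply_eq_one_apply_of_le {n R : Type*} [Fintype n] [LinearOrder n]
    [Semiring R] (l : List (Matrix n n R))
    (hl : ∀ M ∈ l, ∀ a b, a ≤ b → M a b = (1 : Matrix n n R) a b) :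
    ∀ a b, a ≤ b → l.prod a b = (1 : Matrix n n R) a b := by
  induction l with
  | nil => simp
  | cons M l ih =>
    rw [List.prod_cons]
    exact Matrix.mul_apply_eq_one_apply_of_le (hl M List.mem_cons_self)
      (ih fun N hN => hl N (List.mem_cons_of_mem M hN))

theorem Mprime_apply_of_le {F : Type*} [Field F] {m3 m7 : ℕ}
    {θ : Matrix (Fin (m3 + m7)) (Fin (m3 + m7)) F} (hθ : ∀ j j', j ≤ j' → θ j j' = 0)
    (j : Fin m7) (a b : Fin (m3 + m7)) (hab : a ≤ b) :
    Mprime θ j a b = (1 : Matrix (Fin (m3 + m7)) (Fin (m3 + m7)) F) a b := by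
  simp [Mprime, Matrix.one_apply, hθ a b hab]

theorem Pprod_apply_of_le {F : Type*} [Field F] {m3 m7 : ℕ}
    {θ : Matrix (Fin (m3 + m7)) (Fin (m3 + m7)) F} (hθ : ∀ j j', j ≤ j' → θ j j' = 0)
    (a b : Fin (m3 + m7)) (hab : a ≤ b) :
    Pprod θ a b = (1 : Matrix (Fin (m3 + m7)) (Fin (m3 + m7)) F) a b := by
  refine Matrix.list_prod_apply_eq_one_apply_of_le _ (fun M hM => ?_) a b hab
  obtain ⟨j, -, rfl⟩ := List.mem_map.mp hM
  exact Mprime_apply_of_le hθ j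

/-- **The full time-ordered condition implies the causal condition.**
Suppose `θ` satisfies the partial time-ordered condition, `ζ_E` and `η` are strictly
increasing, `H_E j i = (P - I) (ζ_E j) (η i)`, and `w i = {j | ζ_E j ≤ η i}`.
Then (A1) `H_E j i = 0` for `j ∈ w i`, and (A2) `w i ⊆ w i'` for `i ≤ i'`. -/
theorem full_time_ordered_implies_causal
    {F : Type*} [Field F] {m3 m7 m5 m6 : ℕ}
    (θ : Matrix (Fin (m3 + m7)) (Fin (m3 + m7)) F)
    (hθ : ∀ j j' : Fin (m3 + m7), j ≤ j' → θ j j' = 0)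
    (ζE : Fin m6 → Fin (m3 + m7)) (hζE : StrictMono ζE)
    (η : Fin m5 → Fin (m3 + m7)) (hη : StrictMono η)
    (H_E : Matrix (Fin m6) (Fin m5) F)
    (hH : ∀ (j : Fin m6) (i : Fin m5), H_E j i = (Pprod θ - 1) (ζE j) (η i))
    (w : Fin m5 → Set (Fin m6))
    (hw : ∀ i : Fin m5, w i = {j : Fin m6 | ζE j ≤ η i}) :
    (∀ i : Fin m5, ∀ j ∈ w i, H_E j i = 0) ∧
    (∀ i i' : Fin m5, i ≤ i' → w i ⊆ w i') := by
  simp only [hw, Set.mem_ofPred_eq]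
  refine ⟨fun i j hj => ?_, fun i i' hi j hj => ?_⟩
  · rw [hH, Matrix.sub_apply, Pprod_apply_of_le hθ _ _ hj, sub_self]
  · exact le_trans hj (hη.monotone hi)
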